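/- arXiv:2508.07643 — 6 statements merged into one kernel-verified Lean document; each statement's English description precedes it below -/
import Mathlib

section
/- Let S and T be two closed, densely defined operators with common domain 𝔇, each satisfying Hypothesis (T), and such that T and S agree on 𝔥_{χχ̄} (i.e. T P_{χχ̄} = S P_{χχ̄} on 𝔇). Then a closed operator H with domain 𝔇 belongs to the domain of F_{χ,S} if and only if it belongs to the domain of F_{χ,T}, and in either case F_{χ,S}(H) = F_{χ,T}(H) as operators on 𝔇_χ ⊆ 𝔥_χ. -/
open ContinuousLinearMap

noncomputable section

variable {𝔥 : Type*} [NormedAddCommGroup 𝔥] [InnerProductSpace ℂ 𝔥] [CompleteSpace 𝔥]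

/-- Hypothesis (χ): `χ` and `χ̄` are bounded, self-adjoint, positive, mutually
commuting operators with `χ² + χ̄² = 1`, together with the orthogonal projections
`Pχ`, `Pχc` onto the closures `𝔥_χ`, `𝔥_χ̄` of their ranges. -/
structure ChiSetup (𝔥 : Type*) [NormedAddCommGroup 𝔥] [InnerProductSpace ℂ 𝔥]
    [CompleteSpace 𝔥] where
  χ : 𝔥 →L[ℂ] 𝔥
  χc : 𝔥 →L[ℂ] 𝔥
  Pχ : 𝔥 →L[ℂ] 𝔥
  Pχc : 𝔥 →L[ℂ] 𝔥
  χ_pos : χ.IsPositive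
  χc_pos : χc.IsPositive
  comm_χχc : χ ∘L χc = χc ∘L χ
  sum_sq : χ ∘L χ + χc ∘L χc = 1
  Pχ_sa : IsSelfAdjoint Pχ
  Pχ_idem : Pχ ∘L Pχ = Pχ
  Pχ_mem : ∀ x : 𝔥, Pχ x ∈ (LinearMap.range (χ : 𝔥 →ₗ[ℂ] 𝔥)).topologicalClosure
  Pχ_fix : ∀ x ∈ (LinearMap.range (χ : 𝔥 →ₗ[ℂ] 𝔥)).topologicalClosure, Pχ x = x
  Pχc_sa : IsSelfAdjoint Pχc
  Pχc_idem : Pχc ∘L Pχc = Pχc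
  Pχc_mem : ∀ x : 𝔥, Pχc x ∈ (LinearMap.range (χc : 𝔥 →ₗ[ℂ] 𝔥)).topologicalClosure
  Pχc_fix : ∀ x ∈ (LinearMap.range (χc : 𝔥 →ₗ[ℂ] 𝔥)).topologicalClosure, Pχc x = x

namespace ChiSetup

variable (c : ChiSetup 𝔥)

/-- `𝔥_χ`, the closure of the range of `χ`. -/
def Kχ : Submodule ℂ 𝔥 := (LinearMap.range (c.χ : 𝔥 →ₗ[ℂ] 𝔥)).topologicalClosure

/-- `𝔥_χ̄`, the closure of the range of `χ̄`. -/
def Kχc : Submodule ℂ 𝔥 := (LinearMap.range (c.χc : 𝔥 →ₗ[ℂ] 𝔥)).topologicalClosure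

end ChiSetup

/-- `R` is a bounded (everywhere defined on `K`) two-sided inverse of the restriction
of the (possibly unbounded) operator `A`, with domain `D`, to `D ⊓ K`, viewed as an
operator in the closed subspace `K`; this encodes bounded invertibility on `K`. -/
def IsBddInvOn (A : 𝔥 →ₗ[ℂ] 𝔥) (D K : Submodule ℂ 𝔥) (R : 𝔥 →L[ℂ] 𝔥) : Prop :=
  (∀ x, x ∈ D → x ∈ K → A x ∈ K) ∧
  (∀ y ∈ K, R y ∈ D ∧ R y ∈ K ∧ A (R y) = y) ∧
  (∀ x, x ∈ D → x ∈ K → R (A x) = x)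

/-- The restriction of `A` (with domain `D`) to `K` is bounded invertible on `K`. -/
def BddInvOn (A : 𝔥 →ₗ[ℂ] 𝔥) (D K : Submodule ℂ 𝔥) : Prop :=
  ∃ R : 𝔥 →L[ℂ] 𝔥, IsBddInvOn A D K R

/-- Hypothesis (T) for a closed, densely defined operator `T` with domain `D`. -/
structure HypT (c : ChiSetup 𝔥) (D : Submodule ℂ 𝔥) (T : 𝔥 →ₗ[ℂ] 𝔥) : Prop where
  dense : Dense (D : Set 𝔥)
  closedGraph : IsClosed {p : 𝔥 × 𝔥 | p.1 ∈ D ∧ T p.1 = p.2}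
  mapχ : ∀ x ∈ D, c.χ x ∈ D
  mapχc : ∀ x ∈ D, c.χc x ∈ D
  mapPχ : ∀ x ∈ D, c.Pχ x ∈ D
  mapPχc : ∀ x ∈ D, c.Pχc x ∈ D
  commχ : ∀ x ∈ D, c.χ (T x) = T (c.χ x)
  commχc : ∀ x ∈ D, c.χc (T x) = T (c.χc x)
  invχc : BddInvOn T D c.Kχc

/-- The operator `H_{χ̄,T} = T_χ̄ + χ̄ W_T χ̄` (with `W_T = H − T`). -/
def Hbar (c : ChiSetup 𝔥) (T H : 𝔥 →ₗ[ℂ] 𝔥) : 𝔥 →ₗ[ℂ] 𝔥 :=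
  T + (c.χc : 𝔥 →ₗ[ℂ] 𝔥) ∘ₗ (H - T) ∘ₗ (c.χc : 𝔥 →ₗ[ℂ] 𝔥)

/-- `H` belongs to the domain of the smooth Feshbach–Schur map `F_{χ,T}`. -/
structure MemDomF (c : ChiSetup 𝔥) (D : Submodule ℂ 𝔥) (T H : 𝔥 →ₗ[ℂ] 𝔥) : Prop where
  graph_equiv : ∃ C : ℝ, 0 < C ∧ ∀ x ∈ D,
    C * (‖T x‖ + ‖x‖) ≤ ‖H x‖ + ‖x‖ ∧ ‖H x‖ + ‖x‖ ≤ C⁻¹ * (‖T x‖ + ‖x‖)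
  inv : BddInvOn (Hbar c T H) D c.Kχc
  bdd : ∀ R : 𝔥 →L[ℂ] 𝔥, IsBddInvOn (Hbar c T H) D c.Kχc R →
    ∃ C : ℝ, ∀ x, x ∈ D → x ∈ c.Kχ →
      ‖c.χc (R (c.χc ((H - T) (c.χ x))))‖ ≤ C * ‖x‖

/-- The smooth Feshbach–Schur map `F_{χ,T}(H) = T_χ + χ W_T χ − χ W_T χ̄ H_{χ̄,T}⁻¹ χ̄ W_T χ`,
computed with a chosen bounded inverse `R` of `H_{χ̄,T}` on `𝔥_χ̄`. -/
def Fes (c : ChiSetup 𝔥) (T H : 𝔥 →ₗ[ℂ] 𝔥) (R : 𝔥 →L[ℂ] 𝔥) : 𝔥 →ₗ[ℂ] 𝔥 :=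
  T + (c.χ : 𝔥 →ₗ[ℂ] 𝔥) ∘ₗ (H - T) ∘ₗ (c.χ : 𝔥 →ₗ[ℂ] 𝔥)
    - (c.χ : 𝔥 →ₗ[ℂ] 𝔥) ∘ₗ (H - T) ∘ₗ (c.χc : 𝔥 →ₗ[ℂ] 𝔥) ∘ₗ (R : 𝔥 →ₗ[ℂ] 𝔥)
        ∘ₗ (c.χc : 𝔥 →ₗ[ℂ] 𝔥) ∘ₗ (H - T) ∘ₗ (c.χ : 𝔥 →ₗ[ℂ] 𝔥)

/-- The graph of the restriction of `A` to `D`. -/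
def graphOn (A : 𝔥 →ₗ[ℂ] 𝔥) (D : Submodule ℂ 𝔥) : Submodule ℂ (𝔥 × 𝔥) :=
  D.comap (LinearMap.fst ℂ 𝔥 𝔥) ⊓ A.graph

theorem mem_graphOn {E : Type*} [NormedAddCommGroup E] [InnerProductSpace ℂ E]
    {A : E →ₗ[ℂ] E} {D : Submodule ℂ E} {p : E × E} :
    p ∈ graphOn A D ↔ p.1 ∈ D ∧ A p.1 = p.2 := by
  simp [graphOn, LinearMap.mem_graph_iff, eq_comm]

/-- A closed operator is relatively bounded with respect to any closed operator with the same
domain, by the closed graph theorem. -/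
theorem exists_norm_le_graphNorm {A B : 𝔥 →ₗ[ℂ] 𝔥} {D : Submodule ℂ 𝔥}
    (hA : IsClosed {p : 𝔥 × 𝔥 | p.1 ∈ D ∧ A p.1 = p.2})
    (hB : IsClosed {p : 𝔥 × 𝔥 | p.1 ∈ D ∧ B p.1 = p.2}) :
    ∃ M : ℝ, 0 ≤ M ∧ ∀ x ∈ D, ‖B x‖ ≤ M * (‖A x‖ + ‖x‖) := by
  have hG : IsClosed (graphOn A D : Set (𝔥 × 𝔥)) := by
    convert hA using 1
    ext p
    exact mem_graphOn
  have : CompleteSpace (graphOn A D) := hG.completeSpace_coe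
  let f : graphOn A D →ₗ[ℂ] 𝔥 := B ∘ₗ LinearMap.fst ℂ 𝔥 𝔥 ∘ₗ (graphOn A D).subtype
  have hf : Continuous f := by
    apply f.continuous_of_isClosed_graph
    have hc : Continuous fun q : graphOn A D × 𝔥 => ((q.1 : 𝔥 × 𝔥).1, q.2) := by fun_prop
    convert hB.preimage hc using 1
    ext ⟨p, z⟩
    have hp : (p : 𝔥 × 𝔥).1 ∈ D := (mem_graphOn.1 p.2).1
    simp [LinearMap.mem_graph_iff, f, hp, eq_comm]
  let F : graphOn A D →L[ℂ] 𝔥 := ⟨f, hf⟩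
  refine ⟨‖F‖, F.opNorm_nonneg, fun x hx => ?_⟩
  have h := F.le_opNorm ⟨(x, A x), mem_graphOn.2 ⟨hx, rfl⟩⟩
  refine h.trans (mul_le_mul_of_nonneg_left ?_ F.opNorm_nonneg)
  refine (norm_prod_le_iff).2 ⟨?_, ?_⟩ <;> simp

/-- Closed operators with the same domain have equivalent graph norms. -/
theorem graphNorm_equiv {A B : 𝔥 →ₗ[ℂ] 𝔥} {D : Submodule ℂ 𝔥}
    (hA : IsClosed {p : 𝔥 × 𝔥 | p.1 ∈ D ∧ A p.1 = p.2})
    (hB : IsClosed {p : 𝔥 × 𝔥 | p.1 ∈ D ∧ B p.1 = p.2}) :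
    ∃ C : ℝ, 0 < C ∧ ∀ x ∈ D,
      C * (‖A x‖ + ‖x‖) ≤ ‖B x‖ + ‖x‖ ∧ ‖B x‖ + ‖x‖ ≤ C⁻¹ * (‖A x‖ + ‖x‖) := by
  obtain ⟨M, hM, hBA⟩ := exists_norm_le_graphNorm hA hB
  obtain ⟨N, hN, hAB⟩ := exists_norm_le_graphNorm hB hA
  have hpos : 0 < M + N + 1 := by positivity
  refine ⟨(M + N + 1)⁻¹, inv_pos.2 hpos, fun x hx => ⟨?_, ?_⟩⟩
  · rw [inv_mul_le_iff₀ hpos]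
    have := hAB x hx
    nlinarith [norm_nonneg x, norm_nonneg (B x),
      mul_nonneg hM (norm_nonneg (B x)), mul_nonneg hM (norm_nonneg x)]
  · rw [inv_inv]
    have := hBA x hx
    nlinarith [norm_nonneg x, norm_nonneg (A x),
      mul_nonneg hN (norm_nonneg (A x)), mul_nonneg hN (norm_nonneg x)]

theorem map_mem_closure_range {E : Type*} [NormedAddCommGroup E] [InnerProductSpace ℂ E]
    {A B : E →L[ℂ] E} (h : A ∘L B = B ∘L A) {x : E}
    (hx : x ∈ (LinearMap.range (B : E →ₗ[ℂ] E)).topologicalClosure) :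
    A x ∈ (LinearMap.range (B : E →ₗ[ℂ] E)).topologicalClosure := by
  refine map_mem_closure A.continuous hx ?_
  rintro _ ⟨y, rfl⟩
  exact ⟨A y, (DFunLike.congr_fun h y).symm⟩

theorem IsBddInvOn.congr {E : Type*} [NormedAddCommGroup E] [InnerProductSpace ℂ E]
    {A B : E →ₗ[ℂ] E} {D K : Submodule ℂ E} {R : E →L[ℂ] E}
    (hR : IsBddInvOn A D K R) (h : ∀ x, x ∈ D → x ∈ K → A x = B x) : IsBddInvOn B D K R := by
  obtain ⟨h₁, h₂, h₃⟩ := hR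
  refine ⟨fun x hx hK => h x hx hK ▸ h₁ x hx hK, fun y hy => ?_,
    fun x hx hK => h x hx hK ▸ h₃ x hx hK⟩
  obtain ⟨hD, hK, hy'⟩ := h₂ y hy
  exact ⟨hD, hK, h _ hD hK ▸ hy'⟩

theorem IsBddInvOn.eq {E : Type*} [NormedAddCommGroup E] [InnerProductSpace ℂ E]
    {A : E →ₗ[ℂ] E} {D K : Submodule ℂ E} {R R' : E →L[ℂ] E}
    (hR : IsBddInvOn A D K R) (hR' : IsBddInvOn A D K R') {y : E} (hy : y ∈ K) :
    R y = R' y := by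
  obtain ⟨hD, hK, h⟩ := hR.2.1 y hy
  rw [← hR'.2.2 _ hD hK, h]

namespace ChiSetup

variable (c : ChiSetup 𝔥)

theorem χ_mem_Kχ (x : 𝔥) : c.χ x ∈ c.Kχ :=
  Submodule.le_topologicalClosure _ ⟨x, rfl⟩

theorem χc_mem_Kχc (x : 𝔥) : c.χc x ∈ c.Kχc :=
  Submodule.le_topologicalClosure _ ⟨x, rfl⟩

theorem χ_map_Kχc {x : 𝔥} (hx : x ∈ c.Kχc) : c.χ x ∈ c.Kχc :=
  map_mem_closure_range c.comm_χχc hx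

theorem χc_map_Kχ {x : 𝔥} (hx : x ∈ c.Kχ) : c.χc x ∈ c.Kχ :=
  map_mem_closure_range c.comm_χχc.symm hx

theorem χ_χc (x : 𝔥) : c.χ (c.χc x) = c.χc (c.χ x) :=
  DFunLike.congr_fun c.comm_χχc x

theorem χ_χ_add_χc_χc (x : 𝔥) : c.χ (c.χ x) + c.χc (c.χc x) = x :=
  DFunLike.congr_fun c.sum_sq x

end ChiSetup

section Independence

variable {c : ChiSetup 𝔥} {D : Submodule ℂ 𝔥} {S T : 𝔥 →ₗ[ℂ] 𝔥}

theorem HypT.Hbar_apply (hT : HypT c D T) (H : 𝔥 →ₗ[ℂ] 𝔥) {x : 𝔥} (hx : x ∈ D) :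
    Hbar c T H x = T (c.χ (c.χ x)) + c.χc (H (c.χc x)) := by
  have h := congrArg T (c.χ_χ_add_χc_χc x)
  rw [map_add] at h
  simp only [Hbar, LinearMap.add_apply, LinearMap.comp_apply, LinearMap.sub_apply,
    ContinuousLinearMap.coe_coe, map_sub, hT.commχc _ (hT.mapχc x hx)]
  rw [← h]
  abel

theorem Hbar_eq_of_eqOn (hS : HypT c D S) (hT : HypT c D T)
    (hST : ∀ x, x ∈ D → x ∈ c.Kχ → x ∈ c.Kχc → T x = S x) (H : 𝔥 →ₗ[ℂ] 𝔥)
    (x : 𝔥) (hx : x ∈ D) (hK : x ∈ c.Kχc) : Hbar c S H x = Hbar c T H x := by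
  rw [hS.Hbar_apply H hx, hT.Hbar_apply H hx, hST _ (hT.mapχ _ (hT.mapχ x hx))
    (c.χ_mem_Kχ _) (c.χ_map_Kχc (c.χ_map_Kχc hK))]

theorem χc_comp_sub_comp_χ_eq (hS : HypT c D S) (hT : HypT c D T)
    (hST : ∀ x, x ∈ D → x ∈ c.Kχ → x ∈ c.Kχc → T x = S x) (H : 𝔥 →ₗ[ℂ] 𝔥)
    {x : 𝔥} (hx : x ∈ D) : c.χc ((H - S) (c.χ x)) = c.χc ((H - T) (c.χ x)) := by
  simp only [LinearMap.sub_apply, map_sub, hS.commχc _ (hS.mapχ x hx),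
    hT.commχc _ (hT.mapχ x hx)]
  rw [hST _ (hT.mapχc _ (hT.mapχ x hx)) (c.χc_map_Kχ (c.χ_mem_Kχ x)) (c.χc_mem_Kχc _)]

theorem χ_comp_sub_comp_χc_eq (hS : HypT c D S) (hT : HypT c D T)
    (hST : ∀ x, x ∈ D → x ∈ c.Kχ → x ∈ c.Kχc → T x = S x) (H : 𝔥 →ₗ[ℂ] 𝔥)
    {x : 𝔥} (hx : x ∈ D) : c.χ ((H - S) (c.χc x)) = c.χ ((H - T) (c.χc x)) := by
  simp only [LinearMap.sub_apply, map_sub, hS.commχ _ (hS.mapχc x hx),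
    hT.commχ _ (hT.mapχc x hx)]
  rw [hST _ (hT.mapχ _ (hT.mapχc x hx)) (c.χ_mem_Kχ _) (c.χ_map_Kχc (c.χc_mem_Kχc x))]

theorem HypT.add_χ_sub_χ_apply (hT : HypT c D T) (H : 𝔥 →ₗ[ℂ] 𝔥) {x : 𝔥} (hx : x ∈ D) :
    T x + c.χ ((H - T) (c.χ x)) = T (c.χc (c.χc x)) + c.χ (H (c.χ x)) := by
  have h := congrArg T (c.χ_χ_add_χc_χc x)
  rw [map_add] at h
  simp only [LinearMap.sub_apply, map_sub, hT.commχ _ (hT.mapχ x hx)]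
  rw [← h]
  abel

theorem MemDomF.of_eqOn {H : 𝔥 →ₗ[ℂ] 𝔥} (hS : HypT c D S) (hT : HypT c D T)
    (hHclosed : IsClosed {p : 𝔥 × 𝔥 | p.1 ∈ D ∧ H p.1 = p.2})
    (hST : ∀ x, x ∈ D → x ∈ c.Kχ → x ∈ c.Kχc → T x = S x) (h : MemDomF c D S H) :
    MemDomF c D T H where
  graph_equiv := graphNorm_equiv hT.closedGraph hHclosed
  inv := h.inv.imp fun _ hR => hR.congr (Hbar_eq_of_eqOn hS hT hST H)
  bdd R hR := by
    obtain ⟨C, hC⟩ := h.bdd R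
      (hR.congr fun x hx hK => (Hbar_eq_of_eqOn hS hT hST H x hx hK).symm)
    refine ⟨C, fun x hx hK => ?_⟩
    rw [← χc_comp_sub_comp_χ_eq hS hT hST H hx]
    exact hC x hx hK

end Independence

/-- Theorem IND: if `S` and `T` both satisfy Hypothesis (T) with the same
domain `D` and agree on `𝔥_{χχ̄}`, then `H` is in the domain of `F_{χ,S}` iff it is in the
domain of `F_{χ,T}`, and in either case `F_{χ,S}(H) = F_{χ,T}(H)` on `𝔇_χ = D ⊓ 𝔥_χ`. -/
theorem smooth_feshbach_map_independent_of_T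
    (c : ChiSetup 𝔥) (D : Submodule ℂ 𝔥) (S T H : 𝔥 →ₗ[ℂ] 𝔥)
    (hS : HypT c D S) (hT : HypT c D T)
    (hHclosed : IsClosed {p : 𝔥 × 𝔥 | p.1 ∈ D ∧ H p.1 = p.2})
    (hST : ∀ x, x ∈ D → x ∈ c.Kχ → x ∈ c.Kχc → T x = S x) :
    (MemDomF c D S H ↔ MemDomF c D T H) ∧
    ∀ RS RT : 𝔥 →L[ℂ] 𝔥,
      IsBddInvOn (Hbar c S H) D c.Kχc RS →
      IsBddInvOn (Hbar c T H) D c.Kχc RT →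
      ∀ x, x ∈ D → x ∈ c.Kχ → Fes c S H RS x = Fes c T H RT x := by
  refine ⟨⟨MemDomF.of_eqOn hS hT hHclosed hST,
    MemDomF.of_eqOn hT hS hHclosed fun x hx h h' => (hST x hx h h').symm⟩, ?_⟩
  intro RS RT hRS hRT x hx hK
  have hR := (hRS.congr (Hbar_eq_of_eqOn hS hT hST H)).eq hRT
    (c.χc_mem_Kχc ((H - T) (c.χ x)))
  have hD := (hRT.2.1 _ (c.χc_mem_Kχc ((H - T) (c.χ x)))).1
  simp only [Fes, LinearMap.add_apply, LinearMap.sub_apply (_ + _), LinearMap.comp_apply,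
    ContinuousLinearMap.coe_coe]
  rw [hS.add_χ_sub_χ_apply H hx, hT.add_χ_sub_χ_apply H hx,
    χc_comp_sub_comp_χ_eq hS hT hST H hx, hR, χ_comp_sub_comp_χc_eq hS hT hST H hD,
    hST _ (hT.mapχc _ (hT.mapχc x hx)) (c.χc_map_Kχ (c.χc_map_Kχ hK)) (c.χc_mem_Kχc _)]

end
end

section
/- Suppose χ = P is an orthogonal projection (so that χ̄ = P^⊥ := 1 − P), T satisfies Hypothesis (T), and H belongs to the domain of F_{P,T}. Then H_{P^⊥,T} = (P^⊥ H P^⊥)|_{Ran P^⊥} independently of T, and F_{P,T}(H) = (P H P − P H P^⊥ ((P^⊥ H P^⊥)|_{Ran P^⊥})^{-1} P^⊥ H P)|_{Ran P}; in particular F_{P,T}(H) is independent of T and coincides with the sharp (projection-based) Feshbach–Schur map F_P(H). -/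
open ContinuousLinearMap

noncomputable section

variable {𝔥 : Type*} [NormedAddCommGroup 𝔥] [InnerProductSpace ℂ 𝔥] [CompleteSpace 𝔥]

/-- An idempotent operator fixes every vector in the closure of its range. -/
theorem apply_eq_self_of_mem_closure_range {E : Type*} [NormedAddCommGroup E]
    [InnerProductSpace ℂ E] {A : E →L[ℂ] E} (hA : A ∘L A = A) {x : E}
    (hx : x ∈ (LinearMap.range (A : E →ₗ[ℂ] E)).topologicalClosure) : A x = x := by
  have hsub : ((LinearMap.range (A : E →ₗ[ℂ] E) : Submodule ℂ E) : Set E) ⊆ {y | A y = y} := by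
    rintro _ ⟨y, rfl⟩
    exact DFunLike.congr_fun hA y
  exact closure_minimal hsub (isClosed_eq A.continuous continuous_id) hx

/-- if `χ = P` is an orthogonal projection (so `χ̄ = P^⊥ = 1 − P`),
`T` satisfies Hypothesis (T) and `H` is in the domain of `F_{P,T}`, then
`H_{P^⊥,T} = (P^⊥ H P^⊥)|_{Ran P^⊥}` independently of `T`, and `F_{P,T}(H)` equals the
sharp Feshbach–Schur map `F_P(H) = PHP − PHP^⊥ ((P^⊥HP^⊥)|_{Ran P^⊥})⁻¹ P^⊥HP`,
which is independent of `T`. -/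
theorem smooth_feshbach_eq_sharp_of_proj
    (c : ChiSetup 𝔥) (D : Submodule ℂ 𝔥) (T H : 𝔥 →ₗ[ℂ] 𝔥)
    (hT : HypT c D T)
    (hHclosed : IsClosed {p : 𝔥 × 𝔥 | p.1 ∈ D ∧ H p.1 = p.2})
    (hH : MemDomF c D T H)
    (hproj : c.χ ∘L c.χ = c.χ)
    (hperp : c.χc = 1 - c.χ) :
    (∀ x, x ∈ D → x ∈ c.Kχc → Hbar c T H x = c.χc (H (c.χc x))) ∧
    ∀ R : 𝔥 →L[ℂ] 𝔥, IsBddInvOn (Hbar c T H) D c.Kχc R →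
      ∀ x, x ∈ D → x ∈ c.Kχ →
        Fes c T H R x =
          c.χ (H (c.χ x)) - c.χ (H (c.χc (R (c.χc (H (c.χ x)))))) := by
  have hc (y : 𝔥) : c.χc y = y - c.χ y := by simp [hperp]
  have hP (y : 𝔥) : c.χ (c.χ y) = c.χ y := DFunLike.congr_fun hproj y
  have hQ : c.χc ∘L c.χc = c.χc := by
    ext y
    simp [hc, hP]
  have fixP {y : 𝔥} (hy : y ∈ c.Kχ) : c.χ y = y := apply_eq_self_of_mem_closure_range hproj hy
  have fixQ {y : 𝔥} (hy : y ∈ c.Kχc) : c.χc y = y := apply_eq_self_of_mem_closure_range hQ hy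
  have memQ (y : 𝔥) : c.χc y ∈ c.Kχc := Submodule.le_topologicalClosure _ ⟨y, rfl⟩
  refine ⟨fun x hxD hxK => ?_, fun R hR x hxD hxK => ?_⟩
  · have hTx : c.χc (T x) = T x := by rw [hT.commχc x hxD, fixQ hxK]
    simp [Hbar, fixQ hxK, hTx]
  · have hTx : c.χ (T x) = T x := by rw [hT.commχ x hxD, fixP hxK]
    have hQTx : c.χc (T x) = 0 := by rw [hc, hTx, sub_self]
    obtain ⟨hzD, hzK, -⟩ := hR.2.1 (c.χc (H x)) (memQ _)
    set z := R (c.χc (H x)) with hz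
    have hχz : c.χ z = 0 := by
      have h := hc z
      rwa [fixQ hzK, eq_comm, sub_eq_self] at h
    have hTz : c.χ (T z) = 0 := by rw [hT.commχ z hzD, hχz, map_zero]
    simp [Fes, fixP hxK, hTx, hQTx, ← hz, fixQ hzK, hTz]

end
end

section
/- Under the bounded commuting setup, the smooth Feshbach–Schur map F_{χ,T}(H) can be expressed entirely in terms of W_S := H − S: on 𝔥_χ one has F_{χ,T}(H) = S·f_{χ,T}(S) + χ f_{χ,T}(S) W_S f_{χ,T}(S) χ − χ f_{χ,T}(S) W_S χ̄ (H_{χ̄,T})^{-1} χ̄ W_S f_{χ,T}(S) χ. -/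
open ContinuousLinearMap

noncomputable section

variable {𝔥 : Type*} [NormedAddCommGroup 𝔥] [InnerProductSpace ℂ 𝔥] [CompleteSpace 𝔥]

/-- `R` is a two-sided inverse, on the closed subspace `K`, of the restriction to `K`
of the bounded operator `A` (which maps `K` into itself); this encodes that `A|_K` is
bounded invertible on `K` with inverse `R|_K`. -/
def IsInvK (A R : 𝔥 →L[ℂ] 𝔥) (K : Submodule ℂ 𝔥) : Prop :=
  (∀ x ∈ K, A x ∈ K) ∧ ∀ y ∈ K, R y ∈ K ∧ A (R y) = y ∧ R (A y) = y

/-- The bounded commuting setup: `χ, χ̄` are bounded, self-adjoint, positive operators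
with `χ² + χ̄² = 1`; `H, T, S` are bounded operators such that `T, S, χ, χ̄` mutually
commute; `Pχc` is the orthogonal projection onto `𝔥_χ̄ = closure (Ran χ̄)`;
`T|_{𝔥_χ̄}` and `S|_{𝔥_χ̄}` are bounded invertible on `𝔥_χ̄` (with inverses `RT`, `RS`);
`H_{χ̄,T} = T + χ̄(H − T)χ̄` is bounded invertible on `𝔥_χ̄` (with inverse `RH`), so `H`
lies in the domain of `F_{χ,T}`; and `Δ_{χ,T}(S) = Tχ² + Sχ̄²` restricted to `𝔥_χ̄` is
bounded invertible (with inverse `RΔ`). -/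
structure BddSetup (𝔥 : Type*) [NormedAddCommGroup 𝔥] [InnerProductSpace ℂ 𝔥]
    [CompleteSpace 𝔥] where
  χ : 𝔥 →L[ℂ] 𝔥
  χc : 𝔥 →L[ℂ] 𝔥
  Pχc : 𝔥 →L[ℂ] 𝔥
  H : 𝔥 →L[ℂ] 𝔥
  T : 𝔥 →L[ℂ] 𝔥
  S : 𝔥 →L[ℂ] 𝔥
  RT : 𝔥 →L[ℂ] 𝔥
  RS : 𝔥 →L[ℂ] 𝔥
  RH : 𝔥 →L[ℂ] 𝔥
  RΔ : 𝔥 →L[ℂ] 𝔥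
  χ_pos : χ.IsPositive
  χc_pos : χc.IsPositive
  sum_sq : χ ∘L χ + χc ∘L χc = 1
  comm_χχc : χ ∘L χc = χc ∘L χ
  comm_TS : T ∘L S = S ∘L T
  comm_Tχ : T ∘L χ = χ ∘L T
  comm_Tχc : T ∘L χc = χc ∘L T
  comm_Sχ : S ∘L χ = χ ∘L S
  comm_Sχc : S ∘L χc = χc ∘L S
  Pχc_sa : IsSelfAdjoint Pχc
  Pχc_idem : Pχc ∘L Pχc = Pχc
  Pχc_mem : ∀ x : 𝔥, Pχc x ∈ (LinearMap.range (χc : 𝔥 →ₗ[ℂ] 𝔥)).topologicalClosure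
  Pχc_fix : ∀ x ∈ (LinearMap.range (χc : 𝔥 →ₗ[ℂ] 𝔥)).topologicalClosure, Pχc x = x
  invT : IsInvK T RT (LinearMap.range (χc : 𝔥 →ₗ[ℂ] 𝔥)).topologicalClosure
  invS : IsInvK S RS (LinearMap.range (χc : 𝔥 →ₗ[ℂ] 𝔥)).topologicalClosure
  invH : IsInvK (T + χc ∘L (H - T) ∘L χc) RH
    (LinearMap.range (χc : 𝔥 →ₗ[ℂ] 𝔥)).topologicalClosure
  invΔ : IsInvK (T ∘L χ ∘L χ + S ∘L χc ∘L χc) RΔ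
    (LinearMap.range (χc : 𝔥 →ₗ[ℂ] 𝔥)).topologicalClosure

namespace BddSetup

variable {𝔥 : Type*} [NormedAddCommGroup 𝔥] [InnerProductSpace ℂ 𝔥] [CompleteSpace 𝔥]
variable (c : BddSetup 𝔥)

/-- `𝔥_χ`, the closure of the range of `χ`. -/
def Kχ : Submodule ℂ 𝔥 := (LinearMap.range (c.χ : 𝔥 →ₗ[ℂ] 𝔥)).topologicalClosure

/-- `𝔥_χ̄`, the closure of the range of `χ̄`. -/
def Kχc : Submodule ℂ 𝔥 := (LinearMap.range (c.χc : 𝔥 →ₗ[ℂ] 𝔥)).topologicalClosure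

/-- `W_T := H − T`. -/
def WT : 𝔥 →L[ℂ] 𝔥 := c.H - c.T

/-- `W_S := H − S`. -/
def WS : 𝔥 →L[ℂ] 𝔥 := c.H - c.S

/-- `H_{χ̄,T} := T + χ̄ W_T χ̄` (whose restriction to `𝔥_χ̄` is the relevant operator). -/
def HbarT : 𝔥 →L[ℂ] 𝔥 := c.T + c.χc ∘L (c.H - c.T) ∘L c.χc

/-- `Δ_{χ,T}(S) := Tχ² + Sχ̄²`. -/
def Delta : 𝔥 →L[ℂ] 𝔥 := c.T ∘L c.χ ∘L c.χ + c.S ∘L c.χc ∘L c.χc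

/-- `f_{χ,T}(S) := (T (Δ_{χ,T}(S)|_{𝔥_χ̄})⁻¹) ⊕ 1` with respect to `𝔥 = 𝔥_χ̄ ⊕ 𝔥_χ̄^⊥`. -/
def f : 𝔥 →L[ℂ] 𝔥 := c.T ∘L c.RΔ ∘L c.Pχc + (1 - c.Pχc)

/-- The smooth Feshbach–Schur map
`F_{χ,T}(H) = T + χ W_T χ − χ W_T χ̄ (H_{χ̄,T})⁻¹ χ̄ W_T χ` (on `𝔥_χ`). -/
def Fes : 𝔥 →L[ℂ] 𝔥 :=
  c.T + c.χ ∘L c.WT ∘L c.χ - c.χ ∘L c.WT ∘L c.χc ∘L c.RH ∘L c.χc ∘L c.WT ∘L c.χ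

end BddSetup

/-- An inverse `R` of `Δ` on the range of a projection `P` commutes, after composition with `P`,
with everything that commutes with `P` and `Δ`. -/
theorem commute_inverse_mul_projection {A : Type*} [Ring A] {P Δ R a : A}
    (hPR : P * (R * P) = R * P) (hΔR : Δ * (R * P) = P) (hRΔ : R * (Δ * P) = P)
    (haP : Commute a P) (haΔ : Commute a Δ) : Commute a (R * P) := by
  have h : a * (R * P) = P * (a * (R * P)) := by
    rw [← mul_assoc P, ← haP.eq, mul_assoc, hPR]
  calc a * (R * P) = R * (Δ * P) * (a * (R * P)) := by rw [hRΔ, ← h]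
    _ = R * (Δ * (a * (R * P))) := by rw [mul_assoc, mul_assoc Δ, ← h]
    _ = R * P * a := by
      rw [← mul_assoc Δ, ← haΔ.eq, mul_assoc a, hΔR, haP.eq, mul_assoc]

/-- The algebraic identity behind the smooth Feshbach–Schur map: `W` is `H - S`, `D` is `S - T`,
`E` is an inverse of `T + D C²` on the range of `C`, and `R` is an inverse of `T + C (W + D) C`
there. -/
theorem feshbach_ring_identity {A : Type*} [Ring A] {X C T D W E R f : A}
    (hXC : X * X + C * C = 1) (cXC : Commute X C) (cTX : Commute T X) (cTC : Commute T C)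
    (cDX : Commute D X) (cDC : Commute D C) (cTD : Commute T D)
    (cEX : Commute E X) (cEC : Commute E C) (cET : Commute E T) (cED : Commute E D)
    (hE : E * ((T + D * (C * C)) * C) = C)
    (hf : f = 1 - E * D * (C * C))
    (hRG : R * ((T + C * (W + D) * C) * C) = C)
    (hGR : (T + C * (W + D) * C) * (R * C) = C) :
    T + X * (W + D) * X - X * (W + D) * C * R * C * (W + D) * X =
      (T + D) * f + X * f * W * f * X - X * f * W * C * R * C * W * f * X := by
  obtain ⟨Y, hY⟩ : ∃ Y, Y = E * D := ⟨_, rfl⟩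
  have cYX : Commute Y X := hY ▸ cEX.mul_left cDX
  have cYC : Commute Y C := hY ▸ cEC.mul_left cDC
  have cYT : Commute Y T := hY ▸ cET.mul_left cTD.symm
  have cYD : Commute Y D := hY ▸ cED.mul_left (Commute.refl D)
  have hYC : Y * (T * C) + Y * (D * (C * (C * C))) = D * C := by
    calc _ = D * (E * ((T + D * (C * C)) * C)) := by
          rw [hY, ← mul_assoc D E, ← cED.eq]
          noncomm_ring
      _ = D * C := by rw [hE]
  obtain ⟨N, hN⟩ : ∃ N, N = Y * C * X := ⟨_, rfl⟩
  obtain ⟨G, hG⟩ : ∃ G, G = T + C * (W + D) * C := ⟨_, rfl⟩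
  rw [← hG] at hRG hGR
  rw [← hY] at hf
  have hYCX := congrArg (· * X) hYC
  have hYCC := congrArg (· * C) hYC
  have hYCCX := congrArg (· * (C * Y * X * X)) hYC
  have hD := congrArg (D * ·) hXC
  have hYD := congrArg (Y * D * C * C * ·) hXC
  simp only [mul_add, add_mul, mul_assoc, mul_one,
      cYC.symm.eq, cYC.symm.left_comm,
      cYT.symm.left_comm, cYD.symm.left_comm] at hYCX hYCC hYCCX hD hYD
  have hright : C * (W + D) * X = C * W * f * X + G * N := by
    rw [hf, hG, hN]
    simp only [mul_add, add_mul, mul_sub, sub_mul, mul_assoc, mul_one,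
      cYC.symm.left_comm,
      cYT.symm.left_comm, cYD.symm.left_comm,
      cDC.symm.eq]
    rw [← hYCX]
    abel
  have hleft : X * (W + D) * C = X * f * W * C + N * G := by
    rw [hf, hG, hN]
    simp only [mul_add, add_mul, mul_sub, sub_mul, mul_assoc, mul_one,
      cYX.symm.left_comm,
      cDC.symm.eq, cDC.symm.left_comm, cDX.symm.eq, cDX.symm.left_comm,
      cTC.symm.left_comm, cTX.symm.eq,
      cXC.eq, cXC.left_comm]
    rw [← hYCX]
    abel
  have hRN : R * (G * N) = N := by
    rw [hN, cYC.eq, mul_assoc C, ← mul_assoc G, ← mul_assoc R, hRG]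
  have hGRB : G * (R * (C * W * f * X)) = C * W * f * X := by
    simp only [mul_assoc] at hGR ⊢
    rw [← mul_assoc R C, ← mul_assoc G, hGR]
  have hmid : T + X * (W + D) * X = (T + D) * f + X * f * W * f * X
      + X * f * W * C * N + N * (C * W * f * X) + N * (G * N) := by
    rw [hf, hG, hN]
    simp only [mul_add, add_mul, mul_sub, sub_mul, mul_assoc, mul_one,
      cYC.symm.left_comm, cYX.symm.left_comm,
      cYT.symm.left_comm, cYD.symm.left_comm,
      cDC.symm.eq, cDC.symm.left_comm, cDX.symm.eq, cDX.symm.left_comm,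
      cTC.symm.left_comm, cTX.symm.left_comm,
      cXC.eq, cXC.left_comm]
    linear_combination (norm := abel) hD - hYD + hYCC - hYCCX
  have hprod : X * (W + D) * C * R * C * (W + D) * X =
      X * f * W * C * R * (C * W * f * X) + X * f * W * C * N
        + N * (C * W * f * X) + N * (G * N) := by
    calc _ = (X * (W + D) * C) * (R * (C * (W + D) * X)) := by simp only [mul_assoc]
      _ = X * f * W * C * R * (C * W * f * X) + X * f * W * C * (R * (G * N))
        + N * (G * (R * (C * W * f * X))) + N * (G * (R * (G * N))) := by
        rw [hright, hleft]; noncomm_ring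
      _ = _ := by rw [hRN, hGRB]
  rw [hmid, hprod]
  noncomm_ring

theorem BddSetup.Pχc_mul_χc (c : BddSetup 𝔥) : c.Pχc * c.χc = c.χc := by
  ext x
  exact c.Pχc_fix _ (Submodule.le_topologicalClosure _ ⟨x, rfl⟩)

/-- Operators commuting with `χ̄` commute with the projection onto `𝔥_χ̄`. -/
theorem BddSetup.commute_Pχc (c : BddSetup 𝔥) {a : 𝔥 →L[ℂ] 𝔥} (ha : Commute a c.χc) :
    Commute a c.Pχc := by
  have hfix : ∀ y ∈ (LinearMap.range (c.χc : 𝔥 →ₗ[ℂ] 𝔥)).topologicalClosure,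
      c.Pχc (a y) = a y := by
    intro y hy
    refine closure_minimal (t := {y | c.Pχc (a y) = a y}) ?_
      (isClosed_eq (by fun_prop) (by fun_prop)) hy
    rintro _ ⟨x, rfl⟩
    have h := congrArg (fun b : 𝔥 →L[ℂ] 𝔥 => b x) ha.eq
    have h' := congrArg (fun b : 𝔥 →L[ℂ] 𝔥 => b (a x)) c.Pχc_mul_χc
    simp only [mul_apply_eq_comp] at h h'
    change c.Pχc (a (c.χc x)) = a (c.χc x)
    rw [h, h']
  have hker : ∀ z, c.χc z = 0 → c.Pχc z = 0 := by
    intro z hz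
    have horth : ∀ y ∈ (LinearMap.range (c.χc : 𝔥 →ₗ[ℂ] 𝔥)).topologicalClosure,
        inner ℂ y z = 0 := by
      intro y hy
      refine closure_minimal (t := {y | inner ℂ y z = 0}) ?_
        (isClosed_eq (by fun_prop) (by fun_prop)) hy
      rintro _ ⟨x, rfl⟩
      change inner ℂ (c.χc x) z = 0
      rw [← ContinuousLinearMap.adjoint_inner_right, c.χc_pos.isSelfAdjoint.adjoint_eq, hz,
        inner_zero_right]
    rw [← inner_self_eq_zero (𝕜 := ℂ)]
    have h := horth (c.Pχc (c.Pχc z)) (c.Pχc_mem _)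
    rwa [← ContinuousLinearMap.adjoint_inner_right, c.Pχc_sa.adjoint_eq] at h
  have hCP : c.χc * c.Pχc = c.χc := by
    have h := congrArg star c.Pχc_mul_χc
    rwa [star_mul, c.Pχc_sa.star_eq, c.χc_pos.isSelfAdjoint.star_eq] at h
  ext x
  have h1 : c.Pχc (a (c.Pχc x)) = a (c.Pχc x) := hfix _ (c.Pχc_mem x)
  have h2 : c.Pχc (a (x - c.Pχc x)) = 0 := by
    apply hker
    have h := congrArg (fun b : 𝔥 →L[ℂ] 𝔥 => b (x - c.Pχc x)) ha.eq
    have h' := congrArg (fun b : 𝔥 →L[ℂ] 𝔥 => b x) hCP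
    simp only [mul_apply_eq_comp] at h h'
    rw [← h, map_sub, h', sub_self, map_zero]
  rw [map_sub, map_sub, h1, sub_eq_zero] at h2
  exact h2.symm

theorem IsInvK.mul_eq {F : Type*} [NormedAddCommGroup F] [InnerProductSpace ℂ F]
    {A R P : F →L[ℂ] F} {K : Submodule ℂ F} (h : IsInvK A R K)
    (hP : ∀ x, P x ∈ K) : R * (A * P) = P ∧ A * (R * P) = P :=
  ⟨ContinuousLinearMap.ext fun x => (h.2 _ (hP x)).2.2,
    ContinuousLinearMap.ext fun x => (h.2 _ (hP x)).2.1⟩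

/-- on `𝔥_χ`, the smooth Feshbach–Schur map can be expressed entirely
in terms of `W_S = H − S`:
`F_{χ,T}(H) = S f_{χ,T}(S) + χ f W_S f χ − χ f W_S χ̄ (H_{χ̄,T})⁻¹ χ̄ W_S f χ`. -/
theorem feshbach_in_terms_of_WS (c : BddSetup 𝔥) :
    ∀ x ∈ c.Kχ,
      c.Fes x =
        c.S (c.f x) + c.χ (c.f (c.WS (c.f (c.χ x))))
          - c.χ (c.f (c.WS (c.χc (c.RH (c.χc (c.WS (c.f (c.χ x)))))))) := by
  have hmem : ∀ x, c.χc x ∈ (LinearMap.range (c.χc : 𝔥 →ₗ[ℂ] 𝔥)).topologicalClosure :=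
    fun x => Submodule.le_topologicalClosure _ ⟨x, rfl⟩
  have hXC : c.χ * c.χ + c.χc * c.χc = 1 := c.sum_sq
  have cXC : Commute c.χ c.χc := c.comm_χχc
  have cTX : Commute c.T c.χ := c.comm_Tχ
  have cTC : Commute c.T c.χc := c.comm_Tχc
  have cSX : Commute c.S c.χ := c.comm_Sχ
  have cSC : Commute c.S c.χc := c.comm_Sχc
  have cTS : Commute c.T c.S := c.comm_TS
  have hΔ : c.T ∘L c.χ ∘L c.χ + c.S ∘L c.χc ∘L c.χc
      = c.T + (c.S - c.T) * (c.χc * c.χc) := by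
    change c.T * (c.χ * c.χ) + c.S * (c.χc * c.χc) = _
    rw [eq_sub_of_add_eq hXC]
    noncomm_ring
  have invΔ := c.invΔ
  rw [hΔ] at invΔ
  obtain ⟨hRΔ, hΔR⟩ := invΔ.mul_eq c.Pχc_mem
  have hPR : c.Pχc * (c.RΔ * c.Pχc) = c.RΔ * c.Pχc := ContinuousLinearMap.ext fun x =>
    c.Pχc_fix _ (invΔ.2 _ (c.Pχc_mem x)).1
  have cE : ∀ a, Commute a c.χc → Commute a c.T → Commute a c.S →
      Commute (c.RΔ * c.Pχc) a := fun a haC haT haS =>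
    (commute_inverse_mul_projection hPR hΔR hRΔ (c.commute_Pχc haC)
      (haT.add_right ((haS.sub_right haT).mul_right (haC.mul_right haC)))).symm
  have cET := cE c.T cTC (Commute.refl _) cTS
  have cES := cE c.S cSC cTS.symm (Commute.refl _)
  have cEC := cE c.χc (Commute.refl _) cTC.symm cSC.symm
  have cPC : Commute c.χc c.Pχc := c.commute_Pχc (Commute.refl _)
  have cPT := c.commute_Pχc cTC
  have cPS := c.commute_Pχc cSC
  have cPΔ : Commute (c.T + (c.S - c.T) * (c.χc * c.χc)) c.Pχc :=
    cPT.add_left ((cPS.sub_left cPT).mul_left (cPC.mul_left cPC))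
  have hEΔ : c.RΔ * c.Pχc * (c.T + (c.S - c.T) * (c.χc * c.χc)) = c.Pχc := by
    rw [mul_assoc, ← cPΔ.eq, hRΔ]
  have hf : c.f = 1 - c.RΔ * c.Pχc * (c.S - c.T) * (c.χc * c.χc) := by
    change c.T * (c.RΔ * c.Pχc) + (1 - c.Pχc) = _
    rw [← cET.eq]
    nth_rewrite 2 [← hEΔ]
    noncomm_ring
  have hE : c.RΔ * c.Pχc * ((c.T + (c.S - c.T) * (c.χc * c.χc)) * c.χc) = c.χc := by
    rw [← mul_assoc, hEΔ, c.Pχc_mul_χc]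
  have hWT : c.WS + (c.S - c.T) = c.WT := by
    simp only [BddSetup.WS, BddSetup.WT]
    abel
  have hG : c.T + c.χc * (c.WS + (c.S - c.T)) * c.χc
      = c.T + c.χc ∘L (c.H - c.T) ∘L c.χc := by
    rw [hWT]
    rfl
  obtain ⟨hRG, hGR⟩ := c.invH.mul_eq hmem
  rw [← hG] at hRG hGR
  have key := feshbach_ring_identity hXC cXC cTX cTC (cSX.sub_left cTX) (cSC.sub_left cTC)
    (cTS.sub_right (Commute.refl _)) (cE c.χ cXC cTX.symm cSX.symm) cEC cET
    (cES.sub_right cET) hE hf hRG hGR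
  rw [hWT, add_sub_cancel] at key
  intro x _
  exact congrArg (fun b : 𝔥 →L[ℂ] 𝔥 => b x) key

end
end

section
/- Under the bounded commuting setup, the following exchange identity holds as bounded operators from 𝔥 to 𝔥_χ̄: χ̄ W_T − χ̄ W_S f_{χ,T}(S) = H_{χ̄,T} (S − T) (Δ_{χ,T}(S)|_{𝔥_χ̄})^{-1} χ̄. -/
open ContinuousLinearMap

noncomputable section

variable {𝔥 : Type*} [NormedAddCommGroup 𝔥] [InnerProductSpace ℂ 𝔥] [CompleteSpace 𝔥]

namespace BddSetup

variable {𝔥 : Type*} [NormedAddCommGroup 𝔥] [InnerProductSpace ℂ 𝔥] [CompleteSpace 𝔥]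
variable (c : BddSetup 𝔥)

lemma Delta_eq : c.Delta = c.T * (1 - c.χc * c.χc) + c.S * (c.χc * c.χc) := by
  have h : c.χ * c.χ = 1 - c.χc * c.χc := eq_sub_of_add_eq c.sum_sq
  rw [← h]
  rfl

lemma Delta_comm_χc : c.Delta * c.χc = c.χc * c.Delta := by
  have hT : Commute c.χc c.T := c.comm_Tχc.symm
  have hS : Commute c.χc c.S := c.comm_Sχc.symm
  have hχ : Commute c.χc (c.χc * c.χc) := (Commute.refl _).mul_right (Commute.refl _)
  rw [Delta_eq]
  exact ((hT.mul_right ((Commute.one_right _).sub_right hχ)).add_right (hS.mul_right hχ)).symm.eq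

/-- The exchange identity multiplied from the right by `Δ_{χ,T}(S)`. -/
lemma exchange_mul_Delta :
    c.χc * c.WT * c.Delta - c.χc * c.WS * c.T = c.HbarT * (c.S - c.T) * c.χc := by
  have hT : c.χc * c.T = c.T * c.χc := c.comm_Tχc.symm
  have hS : c.χc * c.S = c.S * c.χc := c.comm_Sχc.symm
  have hST : c.S * c.T = c.T * c.S := c.comm_TS.symm
  have hT' (z : 𝔥 →L[ℂ] 𝔥) : c.χc * (c.T * z) = c.T * (c.χc * z) := by
    rw [← mul_assoc, hT, mul_assoc]
  have hS' (z : 𝔥 →L[ℂ] 𝔥) : c.χc * (c.S * z) = c.S * (c.χc * z) := by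
    rw [← mul_assoc, hS, mul_assoc]
  have hST' (z : 𝔥 →L[ℂ] 𝔥) : c.S * (c.T * z) = c.T * (c.S * z) := by
    rw [← mul_assoc, hST, mul_assoc]
  have hH : c.HbarT = c.T + c.χc * ((c.H - c.T) * c.χc) := rfl
  rw [Delta_eq, hH, WT, WS]
  simp only [mul_add, add_mul, mul_sub, sub_mul, mul_one, mul_assoc, hT, hS, hT', hS', hST']
  abel

lemma χc_mem (x : 𝔥) :
    c.χc x ∈ (LinearMap.range (c.χc : 𝔥 →ₗ[ℂ] 𝔥)).topologicalClosure :=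
  Submodule.le_topologicalClosure _ ⟨x, rfl⟩

lemma χc_mul_Pχc : c.χc * c.Pχc = c.χc := by
  have h : c.Pχc * c.χc = c.χc := by
    ext x
    exact c.Pχc_fix _ (c.χc_mem x)
  have h' := congrArg star h
  rwa [star_mul, c.χc_pos.isSelfAdjoint.star_eq, c.Pχc_sa.star_eq] at h'

lemma exchange_apply_of_mem {x : 𝔥}
    (hx : x ∈ (LinearMap.range (c.χc : 𝔥 →ₗ[ℂ] 𝔥)).topologicalClosure) :
    c.χc (c.WT x) - c.χc (c.WS (c.T (c.RΔ x))) = c.HbarT ((c.S - c.T) (c.RΔ (c.χc x))) := by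
  have hΔ : c.Delta (c.RΔ x) = x := (c.invΔ.2 x hx).2.1
  have hR : c.RΔ (c.χc x) = c.χc (c.RΔ x) := by
    have hcomm : c.Delta (c.χc (c.RΔ x)) = c.χc (c.Delta (c.RΔ x)) :=
      DFunLike.congr_fun c.Delta_comm_χc (c.RΔ x)
    rw [hΔ] at hcomm
    rw [← hcomm]
    exact (c.invΔ.2 _ (c.χc_mem _)).2.2
  have h : c.χc (c.WT (c.Delta (c.RΔ x))) - c.χc (c.WS (c.T (c.RΔ x)))
      = c.HbarT ((c.S - c.T) (c.χc (c.RΔ x))) :=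
    DFunLike.congr_fun c.exchange_mul_Delta (c.RΔ x)
  rwa [hΔ, ← hR] at h

lemma χc_WT_eq_χc_WS_of_χc_eq_zero {y : 𝔥} (hy : c.χc y = 0) :
    c.χc (c.WT y) = c.χc (c.WS y) := by
  have hT : c.χc (c.T y) = 0 := by
    rw [← comp_apply, ← c.comm_Tχc, comp_apply, hy, map_zero]
  have hS : c.χc (c.S y) = 0 := by
    rw [← comp_apply, ← c.comm_Sχc, comp_apply, hy, map_zero]
  simp [WT, WS, hT, hS]

end BddSetup

/-- the exchange identity
`χ̄ W_T − χ̄ W_S f_{χ,T}(S) = H_{χ̄,T} (S − T) (Δ_{χ,T}(S)|_{𝔥_χ̄})⁻¹ χ̄`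
as bounded operators from `𝔥` to `𝔥_χ̄`. -/
theorem exchange_identity_left (c : BddSetup 𝔥) :
    c.χc ∘L c.WT - c.χc ∘L c.WS ∘L c.f
      = c.HbarT ∘L (c.S - c.T) ∘L c.RΔ ∘L c.χc := by
  ext x
  have hP : c.χc (c.Pχc x) = c.χc x := DFunLike.congr_fun c.χc_mul_Pχc x
  have hy : c.χc (x - c.Pχc x) = 0 := by rw [map_sub, hP, sub_self]
  have h := c.exchange_apply_of_mem (c.Pχc_mem x)
  have h' := c.χc_WT_eq_χc_WS_of_χc_eq_zero hy
  rw [hP] at h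
  change c.χc (c.WT x) - c.χc (c.WS (c.T (c.RΔ (c.Pχc x)) + (x - c.Pχc x)))
    = c.HbarT ((c.S - c.T) (c.RΔ (c.χc x)))
  rw [← h, map_add, map_add, ← h', map_sub, map_sub]
  abel

end
end

section
/- Under the bounded commuting setup, the following exchange identity holds as bounded operators on 𝔥: W_T χ̄ − f_{χ,T}(S) W_S χ̄ = (S − T) (Δ_{χ,T}(S)|_{𝔥_χ̄})^{-1} χ̄ H_{χ̄,T}, where on the right side χ̄ is regarded as mapping 𝔥 into 𝔥_χ̄ and H_{χ̄,T} acts on 𝔥_χ̄ before χ̄ is applied (i.e. the right side is (S − T) (Δ_{χ,T}(S)|_{𝔥_χ̄})^{-1} composed with χ̄ H_{χ̄,T} P_χ̄). -/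
open ContinuousLinearMap

noncomputable section

variable {𝔥 : Type*} [NormedAddCommGroup 𝔥] [InnerProductSpace ℂ 𝔥] [CompleteSpace 𝔥]

/-- An operator that preserves `K` and commutes with `A` commutes with the inverse of `A|_K`. -/
theorem IsInvK.apply_comm {A R B : 𝔥 →L[ℂ] 𝔥} {K : Submodule ℂ 𝔥} (h : IsInvK A R K)
    (hB : ∀ x ∈ K, B x ∈ K) (hAB : ∀ x, A (B x) = B (A x)) {y : 𝔥} (hy : y ∈ K) :
    R (B y) = B (R y) := by
  obtain ⟨hRy, hARy, -⟩ := h.2 y hy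
  calc R (B y) = R (A (B (R y))) := by rw [hAB, hARy]
    _ = B (R y) := (h.2 _ (hB _ hRy)).2.2

namespace BddSetup

theorem χc_mem_s8 (c : BddSetup 𝔥) (x : 𝔥) : c.χc x ∈ c.Kχc :=
  Submodule.le_topologicalClosure _ ⟨x, rfl⟩

theorem χc_Pχc (c : BddSetup 𝔥) (x : 𝔥) : c.χc (c.Pχc x) = c.χc x := by
  have hP : ∀ u v, inner ℂ (c.Pχc u) v = inner ℂ u (c.Pχc v) :=
    ContinuousLinearMap.isSelfAdjoint_iff_isSymmetric.mp c.Pχc_sa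
  have hχ : ∀ u v, inner ℂ (c.χc u) v = inner ℂ u (c.χc v) :=
    ContinuousLinearMap.isSelfAdjoint_iff_isSymmetric.mp c.χc_pos.isSelfAdjoint
  refine ext_inner_right ℂ fun v => ?_
  rw [hχ, hP, c.Pχc_fix _ (c.χc_mem_s8 v), hχ]

theorem T_χc (c : BddSetup 𝔥) (x : 𝔥) : c.T (c.χc x) = c.χc (c.T x) :=
  DFunLike.congr_fun c.comm_Tχc x

theorem S_χc (c : BddSetup 𝔥) (x : 𝔥) : c.S (c.χc x) = c.χc (c.S x) :=
  DFunLike.congr_fun c.comm_Sχc x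

theorem T_S (c : BddSetup 𝔥) (x : 𝔥) : c.T (c.S x) = c.S (c.T x) :=
  DFunLike.congr_fun c.comm_TS x

theorem Delta_apply (c : BddSetup 𝔥) (x : 𝔥) :
    c.Delta x = c.T x + (c.S (c.χc (c.χc x)) - c.T (c.χc (c.χc x))) := by
  have h : c.χ (c.χ x) + c.χc (c.χc x) = x := DFunLike.congr_fun c.sum_sq x
  have hT : c.T (c.χ (c.χ x)) + c.T (c.χc (c.χc x)) = c.T x := by rw [← map_add, h]
  change c.T (c.χ (c.χ x)) + c.S (c.χc (c.χc x)) = _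
  rw [← hT]
  abel

theorem RΔ_T (c : BddSetup 𝔥) {y : 𝔥} (hy : y ∈ c.Kχc) : c.RΔ (c.T y) = c.T (c.RΔ y) := by
  refine c.invΔ.apply_comm c.invT.1 (fun x => ?_) hy
  change c.Delta _ = c.T (c.Delta _)
  simp only [Delta_apply, map_add, map_sub, T_χc, T_S]

theorem RΔ_S (c : BddSetup 𝔥) {y : 𝔥} (hy : y ∈ c.Kχc) : c.RΔ (c.S y) = c.S (c.RΔ y) := by
  refine c.invΔ.apply_comm c.invS.1 (fun x => ?_) hy
  change c.Delta _ = c.S (c.Delta _)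
  simp only [Delta_apply, map_add, map_sub, S_χc, T_χc, T_S]

theorem RΔ_χc (c : BddSetup 𝔥) {y : 𝔥} (hy : y ∈ c.Kχc) :
    c.RΔ (c.χc y) = c.χc (c.RΔ y) := by
  refine c.invΔ.apply_comm (fun x _ => c.χc_mem_s8 x) (fun x => ?_) hy
  change c.Delta _ = c.χc (c.Delta _)
  simp only [Delta_apply, map_add, map_sub, S_χc, T_χc]

end BddSetup

/-- the exchange identity
`W_T χ̄ − f_{χ,T}(S) W_S χ̄ = (S − T) (Δ_{χ,T}(S)|_{𝔥_χ̄})⁻¹ χ̄ H_{χ̄,T} P_χ̄`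
as bounded operators on `𝔥` (on the right, `χ̄` maps `𝔥` into `𝔥_χ̄` and `H_{χ̄,T}`
acts on `𝔥_χ̄` before `χ̄` is applied). -/
theorem exchange_identity_right (c : BddSetup 𝔥) :
    c.WT ∘L c.χc - c.f ∘L c.WS ∘L c.χc
      = (c.S - c.T) ∘L c.RΔ ∘L c.χc ∘L c.HbarT ∘L c.Pχc := by
  ext x
  have hy := c.χc_mem_s8 x
  set y := c.χc x with hyx
  set w := c.Pχc (c.H y - c.T y) with hw
  have hwK : w ∈ c.Kχc := c.Pχc_mem _
  have hTy : c.Pχc (c.T y) = c.T y := c.Pχc_fix _ (c.invT.1 _ hy)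
  have hSy : c.Pχc (c.S y) = c.S y := c.Pχc_fix _ (c.invS.1 _ hy)
  have hWS : c.Pχc (c.H y - c.S y) = w + c.T y - c.S y := by
    rw [hw, map_sub, map_sub, hTy, hSy]
    abel
  have hΔ : c.T (c.RΔ w) +
      (c.S (c.χc (c.χc (c.RΔ w))) - c.T (c.χc (c.χc (c.RΔ w)))) = w := by
    rw [← c.Delta_apply]
    exact (c.invΔ.2 w hwK).2.1
  have hleft : (c.WT ∘L c.χc - c.f ∘L c.WS ∘L c.χc) x =
      w - c.T (c.RΔ (w + c.T y - c.S y)) := by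
    change c.H y - c.T y - (c.T (c.RΔ (c.Pχc (c.H y - c.S y))) +
      ((c.H y - c.S y) - c.Pχc (c.H y - c.S y))) = _
    rw [hWS]
    abel
  have hinner : c.χc (c.HbarT (c.Pχc x)) = c.T y + c.χc (c.χc w) := by
    change c.χc (c.T (c.Pχc x) + c.χc (c.H (c.χc (c.Pχc x)) - c.T (c.χc (c.Pχc x)))) = _
    rw [map_add, ← c.T_χc, c.χc_Pχc, ← hyx, hw, c.χc_Pχc]
  have hright : ((c.S - c.T) ∘L c.RΔ ∘L c.χc ∘L c.HbarT ∘L c.Pχc) x =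
      c.S (c.T (c.RΔ y) + c.χc (c.χc (c.RΔ w))) -
        c.T (c.T (c.RΔ y) + c.χc (c.χc (c.RΔ w))) := by
    change c.S (c.RΔ (c.χc (c.HbarT (c.Pχc x)))) - c.T (c.RΔ (c.χc (c.HbarT (c.Pχc x)))) = _
    rw [hinner, map_add, c.RΔ_T hy, c.RΔ_χc (c.χc_mem_s8 w), c.RΔ_χc hwK]
  rw [hleft, hright]
  simp only [map_add, map_sub, c.RΔ_T hy, c.RΔ_S hy, c.T_S]
  nth_rewrite 1 [← hΔ]
  abel

end
end

section
/- Let H (closed, with domain 𝔇) be in the domain of F_{χ,T}, set W := H − T, and on the Hilbert space 𝔥̂ := 𝔥_χ ⊕ 𝔥_χ̄ define the operator Ĥ with domain P_χ𝔇 ⊕ P_χ̄𝔇 by the block matrix Ĥ := [[T_χ + χWχ, χWχ̄],[χ̄Wχ, T_χ̄ + χ̄Wχ̄]], and define the isometry J : 𝔥 → 𝔥̂ by Jφ := (χφ, χ̄φ). Then dom(ĤJ) = 𝔇 and Ĥ J φ = J H φ for every φ ∈ 𝔇; consequently J* Ĥ J = H on 𝔇. -/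
open ContinuousLinearMap

noncomputable section

variable {𝔥 : Type*} [NormedAddCommGroup 𝔥] [InnerProductSpace ℂ 𝔥] [CompleteSpace 𝔥]

/-- The embedding `J : 𝔥 → 𝔥̂ = 𝔥_χ ⊕ 𝔥_χ̄`, `Jφ = (χφ, χ̄φ)`. -/
def Jmap (c : ChiSetup 𝔥) (φ : 𝔥) : 𝔥 × 𝔥 := (c.χ φ, c.χc φ)

/-- The adjoint `J* : 𝔥̂ → 𝔥`, `J*(f,g) = χf + χ̄g`. -/
def Jstar (c : ChiSetup 𝔥) (p : 𝔥 × 𝔥) : 𝔥 := c.χ p.1 + c.χc p.2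

/-- The block operator `Ĥ = [[T_χ + χWχ, χWχ̄],[χ̄Wχ, T_χ̄ + χ̄Wχ̄]]` (with `W = H − T`)
on `𝔥̂ = 𝔥_χ ⊕ 𝔥_χ̄`. -/
def Hhat (c : ChiSetup 𝔥) (T H : 𝔥 →ₗ[ℂ] 𝔥) (p : 𝔥 × 𝔥) : 𝔥 × 𝔥 :=
  (T p.1 + c.χ ((H - T) (c.χ p.1)) + c.χ ((H - T) (c.χc p.2)),
   c.χc ((H - T) (c.χ p.1)) + T p.2 + c.χc ((H - T) (c.χc p.2)))

namespace ChiSetup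

theorem χ_sq_add_χc_sq_apply (c : ChiSetup 𝔥) (x : 𝔥) :
    c.χ (c.χ x) + c.χc (c.χc x) = x := by
  simpa using congrArg (fun A : 𝔥 →L[ℂ] 𝔥 => A x) c.sum_sq

theorem Pχ_χ_apply (c : ChiSetup 𝔥) (x : 𝔥) : c.Pχ (c.χ x) = c.χ x :=
  c.Pχ_fix _ (Submodule.le_topologicalClosure _ ⟨x, rfl⟩)

theorem Pχc_χc_apply (c : ChiSetup 𝔥) (x : 𝔥) : c.Pχc (c.χc x) = c.χc x :=
  c.Pχc_fix _ (Submodule.le_topologicalClosure _ ⟨x, rfl⟩)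

end ChiSetup

theorem Jstar_Jmap (c : ChiSetup 𝔥) (φ : 𝔥) : Jstar c (Jmap c φ) = φ :=
  c.χ_sq_add_χc_sq_apply φ

theorem HypT.domain_Jmap {c : ChiSetup 𝔥} {D : Submodule ℂ 𝔥} {T : 𝔥 →ₗ[ℂ] 𝔥}
    (hT : HypT c D T) :
    {φ : 𝔥 | c.χ φ ∈ c.Pχ '' (D : Set 𝔥) ∧ c.χc φ ∈ c.Pχc '' (D : Set 𝔥)} = (D : Set 𝔥) := by
  ext φ
  constructor
  · rintro ⟨⟨x, hx, hxφ⟩, y, hy, hyφ⟩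
    have hχ : c.χ (c.χ φ) ∈ D := hT.mapχ _ (hxφ ▸ hT.mapPχ x hx)
    have hχc : c.χc (c.χc φ) ∈ D := hT.mapχc _ (hyφ ▸ hT.mapPχc y hy)
    exact c.χ_sq_add_χc_sq_apply φ ▸ D.add_mem hχ hχc
  · intro hφ
    exact ⟨⟨c.χ φ, hT.mapχ φ hφ, c.Pχ_χ_apply φ⟩, c.χc φ, hT.mapχc φ hφ, c.Pχc_χc_apply φ⟩

theorem HypT.Hhat_Jmap {c : ChiSetup 𝔥} {D : Submodule ℂ 𝔥} {T : 𝔥 →ₗ[ℂ] 𝔥}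
    (hT : HypT c D T) (H : 𝔥 →ₗ[ℂ] 𝔥) {φ : 𝔥} (hφ : φ ∈ D) :
    Hhat c T H (Jmap c φ) = Jmap c (H φ) := by
  have hW : (H - T) (c.χ (c.χ φ)) + (H - T) (c.χc (c.χc φ)) = H φ - T φ := by
    rw [← map_add, c.χ_sq_add_χc_sq_apply, LinearMap.sub_apply]
  refine Prod.ext ?_ ?_
  · change T (c.χ φ) + c.χ ((H - T) (c.χ (c.χ φ))) + c.χ ((H - T) (c.χc (c.χc φ))) = c.χ (H φ)
    rw [add_assoc, ← map_add c.χ, hW, ← hT.commχ φ hφ, ← map_add, add_sub_cancel]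
  · change c.χc ((H - T) (c.χ (c.χ φ))) + T (c.χc φ) + c.χc ((H - T) (c.χc (c.χc φ))) =
      c.χc (H φ)
    rw [add_right_comm, ← map_add c.χc, hW, ← hT.commχc φ hφ, ← map_add, sub_add_cancel]

/-- for `H` in the domain of `F_{χ,T}`, the block operator `Ĥ` on
`𝔥̂ = 𝔥_χ ⊕ 𝔥_χ̄`, with domain `P_χ𝔇 ⊕ P_χ̄𝔇`, satisfies `dom(ĤJ) = 𝔇`,
`ĤJφ = JHφ` for all `φ ∈ 𝔇`, and consequently `J*ĤJ = H` on `𝔇`. -/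
theorem block_operator_conjugation
    (c : ChiSetup 𝔥) (D : Submodule ℂ 𝔥) (T H : 𝔥 →ₗ[ℂ] 𝔥)
    (hT : HypT c D T)
    (hHclosed : IsClosed {p : 𝔥 × 𝔥 | p.1 ∈ D ∧ H p.1 = p.2})
    (hH : MemDomF c D T H) :
    {φ : 𝔥 | c.χ φ ∈ c.Pχ '' (D : Set 𝔥) ∧ c.χc φ ∈ c.Pχc '' (D : Set 𝔥)}
      = (D : Set 𝔥) ∧
    (∀ φ ∈ D, Hhat c T H (Jmap c φ) = Jmap c (H φ)) ∧
    (∀ φ ∈ D, Jstar c (Hhat c T H (Jmap c φ)) = H φ) := by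
  refine ⟨hT.domain_Jmap, fun φ hφ => hT.Hhat_Jmap H hφ, fun φ hφ => ?_⟩
  rw [hT.Hhat_Jmap H hφ, Jstar_Jmap]

end
end
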